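/- (Theorem 5.3(b), local linear convergence of DBA-sGS-ALM) In the setting of Theorem 5.3(a), let u^k := (y^k, ȳ^k, z^k, z̄^k, x^k, x̄^k) be the sequence generated by DBA-sGS-ALM, suppose u^k converges to a KKT point û, and suppose the KKT mapping R is metrically subregular at (û, 0) ∈ gph R. If instead of the summable absolute error criterion the relative error criterion ‖Δ^k‖ ≤ η_k ‖u^k − u^{k+1}‖ is employed, where {η_k} is a given sequence of nonnegative numbers converging to 0, then the sequence {u^k} converges locally linearly to û. -/

import Mathlib

/- STATEMENT 6 (Theorem 5.3(b)): local linear convergence of DBA-sGS-ALM under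
   metric subregularity of the KKT mapping and the relative error criterion
   ‖Δ^k‖ ≤ η_k ‖u^k − u^{k+1}‖ with η_k ≥ 0, η_k → 0.
   Setting as in Theorem 5.3(a) (see stmt_5), with the projections Π_K, Π_K̄
   supplied as data together with their defining minimization properties.
   Norms of tuples are the ℓ²-sums √(Σ‖·‖²) of the block norms.  The conclusion
   is local (eventual) R-linear convergence of u^k = (y^k,ȳ^k,z^k,z̄^k,x^k,x̄^k)
   to the KKT point û. -/

open scoped RealInnerProductSpace
open ContinuousLinearMap (adjoint)

noncomputable section

open Classical in
def indE {E : Type*} [NormedAddCommGroup E] [InnerProductSpace ℝ E]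
    (K : Set E) (x : E) : EReal := if x ∈ K then 0 else ⊤

def conjFn {E : Type*} [NormedAddCommGroup E] [InnerProductSpace ℝ E]
    (f : E → EReal) (w : E) : EReal := ⨆ u, ((⟪w, u⟫ : ℝ) : EReal) - f u

def IsProjPt {E : Type*} [NormedAddCommGroup E] [InnerProductSpace ℝ E]
    (K : Set E) (w p : E) : Prop := p ∈ K ∧ ∀ u ∈ K, ‖w - p‖ ≤ ‖w - u‖

variable {X Y Xb Yb : Type*}
  [NormedAddCommGroup X] [InnerProductSpace ℝ X] [FiniteDimensional ℝ X]
  [NormedAddCommGroup Y] [InnerProductSpace ℝ Y] [FiniteDimensional ℝ Y]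
  [NormedAddCommGroup Xb] [InnerProductSpace ℝ Xb] [FiniteDimensional ℝ Xb]
  [NormedAddCommGroup Yb] [InnerProductSpace ℝ Yb] [FiniteDimensional ℝ Yb]

def LsigALM (σ : ℝ) (K : Set X) (Kb : Set Xb)
    (b : Y) (bb : Yb) (c : X) (cb : Xb)
    (A : X →L[ℝ] Y) (B : X →L[ℝ] Yb) (Bb : Xb →L[ℝ] Yb)
    (z : X) (zb : Xb) (y : Y) (yb : Yb) (x : X) (xb : Xb) : EReal :=
  conjFn (indE K) (-z) + conjFn (indE Kb) (-zb) +
  ((- ⟪b, y⟫ - ⟪bb, yb⟫ - 1/(2*σ) * ‖x‖^2 - 1/(2*σ) * ‖xb‖^2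
    + σ/2 * ‖adjoint A y + adjoint B yb + z - c + σ⁻¹ • x‖^2
    + σ/2 * ‖adjoint Bb yb + zb - cb + σ⁻¹ • xb‖^2 : ℝ) : EReal)

/-- Squared ℓ²-distance between two tuples u = (y,ȳ,z,z̄,x,x̄). -/
def distSq6 (y1 : Y) (yb1 : Yb) (z1 : X) (zb1 : Xb) (x1 : X) (xb1 : Xb)
    (y2 : Y) (yb2 : Yb) (z2 : X) (zb2 : Xb) (x2 : X) (xb2 : Xb) : ℝ :=
  ‖y1 - y2‖^2 + ‖yb1 - yb2‖^2 + ‖z1 - z2‖^2 + ‖zb1 - zb2‖^2 +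
  ‖x1 - x2‖^2 + ‖xb1 - xb2‖^2

lemma form_bounds {E : Type*} [NormedAddCommGroup E] [NormedSpace ℝ E] [FiniteDimensional ℝ E]
    (Q : E → ℝ) (hc : Continuous Q) (hh : ∀ (t : ℝ) v, Q (t • v) = t^2 * Q v)
    (hp : ∀ v, v ≠ 0 → 0 < Q v) :
    ∃ m M : ℝ, 0 < m ∧ 0 < M ∧ ∀ v, m * ‖v‖^2 ≤ Q v ∧ Q v ≤ M * ‖v‖^2 := by
  have : ProperSpace E := FiniteDimensional.proper ℝ E
  have hcomp : IsCompact (Metric.sphere (0:E) 1) := isCompact_sphere 0 1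
  obtain ⟨m, hm, hm'⟩ := hcomp.exists_forall_le' (a := (0:ℝ)) hc.continuousOn (by
    intro x hx
    apply hp
    intro h; simp [h] at hx)
  obtain ⟨M, hM⟩ := hcomp.bddAbove_image hc.continuousOn
  refine ⟨m, max M 1, hm, lt_of_lt_of_le one_pos (le_max_right _ _), ?_⟩
  intro v
  by_cases hv : v = 0
  · have : Q v = 0 := by
      have := hh 0 v
      simpa [hv] using this
    rw [this]; simp [hv]
  · have hn : 0 < ‖v‖ := norm_pos_iff.2 hv
    have hs : ‖v‖⁻¹ • v ∈ Metric.sphere (0:E) 1 := by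
      simp [norm_smul, hn.ne']
    have e : Q v = ‖v‖^2 * Q (‖v‖⁻¹ • v) := by
      rw [hh]; field_simp
    have h1 := hm' _ hs
    have h2 : Q (‖v‖⁻¹ • v) ≤ max M 1 := le_trans (hM ⟨_, hs, rfl⟩) (le_max_left _ _)
    rw [e]
    have := sq_nonneg ‖v‖
    constructor <;> nlinarith

lemma abs_conv {V : Type*} [NormedAddCommGroup V] (u : ℕ → V) (uh : V) (Ω : Set V)
    (hΩ : Ω.Nonempty) (Q : V → ℝ) (m M β L : ℝ) (m0 : 0 < m) (M0 : 0 < M) (β0 : 0 < β)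
    (L0 : 0 < L) (hm : ∀ v, m * ‖v‖^2 ≤ Q v) (hM : ∀ v, Q v ≤ M * ‖v‖^2)
    (e : ℕ → ℝ) (he0 : ∀ k, 0 ≤ e k) (he : Filter.Tendsto e Filter.atTop (nhds 0))
    (hdec : ∀ k, ∀ ω ∈ Ω, Q (u (k+1) - ω) ≤ Q (u k - ω) - β * ‖u (k+1) - u k‖^2
      + e k * ‖u (k+1) - u k‖ * ‖u (k+1) - ω‖)
    (hinf : ∀ᶠ k in Filter.atTop, Metric.infDist (u (k+1)) Ω ≤ L * ‖u (k+1) - u k‖)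
    (hlim : Filter.Tendsto u Filter.atTop (nhds uh)) :
    ∃ C : ℝ, 0 < C ∧ ∃ ρ : ℝ, ρ ∈ Set.Ico (0 : ℝ) 1 ∧
      ∀ᶠ k in Filter.atTop, ‖u k - uh‖ ≤ C * ρ ^ k := by
  have : Nonempty Ω := hΩ.to_subtype
  set D : ℕ → ℝ := fun k => ⨅ ω : Ω, Q (u k - ω) with hD
  have Q0 : ∀ v, 0 ≤ Q v := fun v => le_trans (by positivity) (hm v)
  have bdd : ∀ k, BddBelow (Set.range fun ω : Ω => Q (u k - ω)) := fun k =>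
    ⟨0, by rintro _ ⟨ω, rfl⟩; exact Q0 _⟩
  have D0 : ∀ k, 0 ≤ D k := fun k => le_ciInf fun ω => Q0 _
  set κ : ℝ := β / (2 * M * L^2) with hκ
  have κ0 : 0 < κ := by positivity
  have hε : ∀ᶠ k in Filter.atTop, e k < min (β/4) (m * κ / 2) :=
    he.eventually_lt_const (by positivity)
  obtain ⟨N, hN⟩ := Filter.eventually_atTop.1 (hε.and hinf)
  have key1 : ∀ k, N ≤ k → D (k+1) + β/2 * ‖u (k+1) - u k‖^2 ≤ (1 + κ/2) * D k := by
    intro k hk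
    obtain ⟨h1, -⟩ := hN k hk
    have h1a : e k ≤ β/4 := (h1.trans_le (min_le_left _ _)).le
    have h1b : e k ≤ m * κ/2 := (h1.trans_le (min_le_right _ _)).le
    rw [← div_le_iff₀' (by positivity)]
    refine le_ciInf fun ω => ?_
    rw [div_le_iff₀' (by positivity)]
    have h2 := hdec k ω ω.2
    have h3 : D (k+1) ≤ Q (u (k+1) - ω) := ciInf_le (bdd (k+1)) ω
    have h4 : ‖u (k+1) - ω‖ ≤ ‖u (k+1) - u k‖ + ‖u k - ω‖ := by
      have := norm_add_le (u (k+1) - u k) (u k - ω)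
      simpa using this
    have h5 := hm (u k - ω)
    set d := ‖u (k+1) - u k‖
    set a := ‖u k - ω‖
    have d0 : 0 ≤ d := norm_nonneg _
    have a0 : 0 ≤ a := norm_nonneg _
    have h6 : e k * d * ‖u (k+1) - ω‖ ≤ e k * (2 * d^2 + a^2) := by
      rw [mul_assoc]
      refine mul_le_mul_of_nonneg_left ?_ (he0 k)
      nlinarith [mul_le_mul_of_nonneg_left h4 d0, sq_nonneg (d - a)]
    have h7 : e k * (2*d^2) ≤ β/4 * (2*d^2) := mul_le_mul_of_nonneg_right h1a (by positivity)
    have h8 : e k * a^2 ≤ m*κ/2 * a^2 := mul_le_mul_of_nonneg_right h1b (by positivity)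
    nlinarith
  have key2 : ∀ k, N ≤ k → D (k+1) ≤ M * L^2 * ‖u (k+1) - u k‖^2 := by
    intro k hk
    obtain ⟨-, h1⟩ := hN k hk
    set d := ‖u (k+1) - u k‖
    have d0 : 0 ≤ d := norm_nonneg _
    have hh : ∀ s, L * d < s → D (k+1) ≤ M * s^2 := by
      intro s hs
      obtain ⟨ω, hω, hd⟩ := (Metric.infDist_lt_iff hΩ).1 (h1.trans_lt hs)
      rw [dist_eq_norm] at hd
      have h3 : D (k+1) ≤ Q (u (k+1) - ω) := ciInf_le (bdd (k+1)) ⟨ω, hω⟩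
      refine h3.trans ((hM _).trans ?_)
      gcongr
    have ht : Filter.Tendsto (fun s : ℝ => M * s^2) (nhdsWithin (L*d) (Set.Ioi (L*d)))
        (nhds (M * (L*d)^2)) := by
      apply Filter.Tendsto.mono_left _ nhdsWithin_le_nhds
      exact (by fun_prop : Continuous fun s : ℝ => M * s^2).tendsto _
    have := ge_of_tendsto ht (Filter.eventually_of_mem self_mem_nhdsWithin hh)
    nlinarith
  set q : ℝ := (1 + κ/2) / (1+κ) with hq
  have q0 : 0 < q := by positivity
  have q1 : q < 1 := by rw [hq, div_lt_one (by positivity)]; linarith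
  have key3 : ∀ k, N ≤ k → D (k+1) ≤ q * D k := by
    intro k hk
    have h1 := key1 k hk
    have h2 := key2 k hk
    have h3 : κ * D (k+1) ≤ β/2 * ‖u (k+1) - u k‖^2 := by
      have := mul_le_mul_of_nonneg_left h2 κ0.le
      refine this.trans (le_of_eq ?_)
      rw [hκ]; field_simp
    rw [hq, div_mul_eq_mul_div, le_div_iff₀ (by positivity)]
    nlinarith
  have key4 : ∀ j, D (N + j) ≤ D N * q^j := by
    intro j
    induction j with
    | zero => simp
    | succ j ih =>
      have := key3 (N+j) (by omega)
      rw [← add_assoc, pow_succ]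
      nlinarith
  set c := 2/β * (1+κ/2) * D N with hc
  have c0 : 0 ≤ c := by have := D0 N; positivity
  set s := Real.sqrt q with hs
  have s0 : 0 < s := Real.sqrt_pos.2 q0
  have s1 : s < 1 := by rw [hs, Real.sqrt_lt' one_pos]; simpa using q1
  have key5 : ∀ j, dist (u (N + j)) (u (N + (j+1))) ≤ Real.sqrt c * s^j := by
    intro j
    rw [dist_comm, dist_eq_norm]
    refine (sq_le_sq₀ (norm_nonneg _) (by positivity)).1 ?_
    rw [mul_pow, Real.sq_sqrt c0, ← pow_mul, mul_comm j 2, pow_mul, hs, Real.sq_sqrt q0.le]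
    have h1 := key1 (N+j) (by omega)
    have h2 := key4 j
    have h3 := D0 (N+j+1)
    have h4 : β/2 * ‖u (N+j+1) - u (N+j)‖^2 ≤ (1+κ/2) * (D N * q^j) := by nlinarith
    rw [← add_assoc]
    have h5 : ‖u (N+j+1) - u (N+j)‖^2 = 2/β * (β/2 * ‖u (N+j+1) - u (N+j)‖^2) := by
      field_simp
    rw [h5, hc]
    have := mul_le_mul_of_nonneg_left h4 (by positivity : 0 ≤ 2/β)
    linarith
  have hlim' : Filter.Tendsto (fun j => u (N + j)) Filter.atTop (nhds uh) := by
    have := (Filter.tendsto_add_atTop_iff_nat N).2 hlim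
    simpa [add_comm] using this
  refine ⟨(Real.sqrt c + 1) / (1 - s) / s^N, ?_, s, ⟨s0.le, s1⟩, ?_⟩
  · have : 0 < 1 - s := by linarith
    positivity
  · filter_upwards [Filter.eventually_ge_atTop N] with k hk
    obtain ⟨j, rfl⟩ := Nat.exists_eq_add_of_le hk
    have := dist_le_of_le_geometric_of_tendsto s (Real.sqrt c) s1 key5 hlim' j
    rw [dist_eq_norm] at this
    refine this.trans ?_
    have h1s : 0 < 1 - s := by linarith
    rw [pow_add]
    have : (Real.sqrt c + 1) / (1 - s) / s^N * (s^N * s^j) = (Real.sqrt c + 1) * s^j / (1-s) := by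
      field_simp
    rw [this]
    gcongr
    linarith


lemma proj_vi {E : Type*} [NormedAddCommGroup E] [InnerProductSpace ℝ E]
    {K : Set E} (hKcv : Convex ℝ K) {w p : E} (h : IsProjPt K w p) :
    ∀ u ∈ K, ⟪w - p, u - p⟫ ≤ 0 := by
  rw [← norm_eq_iInf_iff_real_inner_le_zero hKcv h.1]
  have : Nonempty K := ⟨⟨p, h.1⟩⟩
  apply le_antisymm
  · exact le_ciInf fun u => h.2 u u.2
  · exact ciInf_le ⟨0, by rintro _ ⟨u, rfl⟩; exact norm_nonneg _⟩ (⟨p, h.1⟩ : K)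

lemma conj_le_iff {E : Type*} [NormedAddCommGroup E] [InnerProductSpace ℝ E]
    (K : Set E) (w : E) (a : EReal) :
    conjFn (indE K) w ≤ a ↔ ∀ u ∈ K, ((⟪w, u⟫ : ℝ) : EReal) ≤ a := by
  unfold conjFn indE
  rw [iSup_le_iff]
  refine forall_congr' fun u => ?_
  by_cases h : u ∈ K <;> simp [h]

lemma conj_ne_bot {E : Type*} [NormedAddCommGroup E] [InnerProductSpace ℝ E]
    {K : Set E} (hK : K.Nonempty) (w : E) : conjFn (indE K) w ≠ ⊥ := by
  intro h
  obtain ⟨u, hu⟩ := hK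
  have := (conj_le_iff K w ⊥).1 h.le u hu
  simp at this

lemma lin_nonneg {a c : ℝ} (h : ∀ t : ℝ, 0 < t → t ≤ 1 → 0 ≤ t * a + t^2 * c) : 0 ≤ a := by
  by_contra ha
  push Not at ha
  have hc := h 1 one_pos le_rfl
  have hc0 : 0 < c := by linarith
  have ht : 0 < min 1 (-a / (2*c)) := lt_min one_pos (div_pos (by linarith) (by linarith))
  have h2 := h _ ht (min_le_left _ _)
  have h3 : min 1 (-a/(2*c)) ≤ -a/(2*c) := min_le_right _ _
  set t := min 1 (-a/(2*c))
  rw [le_div_iff₀ (by linarith)] at h3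
  nlinarith

lemma prox_block {E : Type*} [NormedAddCommGroup E] [InnerProductSpace ℝ E]
    {K : Set E} (hKne : K.Nonempty) (hKcv : Convex ℝ K) (PiK : E → E)
    (hPiK : ∀ w, IsProjPt K w (PiK w)) (zp v : E) (hfin : conjFn (indE K) (-zp) ≠ ⊤)
    (h : ∀ d : E, ∃ q : ℝ, ∀ t : ℝ, 0 < t → t ≤ 1 →
      conjFn (indE K) (-zp) ≤ conjFn (indE K) (-(zp + t • d))
        + ((t * ⟪v, d⟫ + t^2 * q : ℝ) : EReal)) :
    v ∈ K ∧ ∀ u ∈ K, ⟪-zp, u - v⟫ ≤ 0 := by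
  obtain ⟨a, ha⟩ : ∃ a : ℝ, conjFn (indE K) (-zp) = (a : EReal) :=
    ⟨_, (EReal.coe_toReal hfin (conj_ne_bot hKne _)).symm⟩
  have hau : ∀ u ∈ K, ⟪-zp, u⟫ ≤ a := fun u hu => by
    exact_mod_cast (conj_le_iff K (-zp) a).1 ha.le u hu
  -- reduction to reals
  have red : ∀ d : E, ∀ s : ℝ, (∀ t : ℝ, 0 < t → t ≤ 1 → ∀ u ∈ K, ⟪-(zp + t • d), u⟫ ≤ a + t * s) →
      0 ≤ s + ⟪v, d⟫ := by
    intro d s hs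
    obtain ⟨q, hq⟩ := h d
    apply lin_nonneg (c := q)
    intro t t0 t1
    have h1 := hq t t0 t1
    have h2 : conjFn (indE K) (-(zp + t • d)) ≤ ((a + t * s : ℝ) : EReal) :=
      (conj_le_iff K _ _).2 fun u hu => by exact_mod_cast hs t t0 t1 u hu
    have h3 := h1.trans (add_le_add_left h2 _)
    rw [ha, ← EReal.coe_add, EReal.coe_le_coe_iff] at h3
    linarith
  have hv : v = PiK v := by
    have hp := proj_vi hKcv (hPiK v)
    have := red (-(v - PiK v)) ⟪v - PiK v, PiK v⟫ (by
      intro t t0 t1 u hu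
      have h1 := hau u hu
      have h2 := hp u hu
      have e : ⟪-(zp + t • -(v - PiK v)), u⟫ = ⟪-zp, u⟫ + t * ⟪v - PiK v, u⟫ := by
        rw [neg_add, smul_neg, neg_neg, inner_add_left, real_inner_smul_left]
      rw [inner_sub_right] at h2
      rw [e]
      nlinarith)
    rw [inner_neg_right, real_inner_comm] at this
    have h3 : ⟪v - PiK v, v - PiK v⟫ ≤ 0 := by
      rw [inner_sub_right (v - PiK v)]
      have h4 := real_inner_comm v (v - PiK v)
      have h5 := real_inner_comm (PiK v) (v - PiK v)
      linarith
    exact sub_eq_zero.1 (real_inner_self_nonpos.1 h3)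
  refine ⟨hv ▸ (hPiK v).1, ?_⟩
  have := red (-zp) (-a) (by
    intro t t0 t1 u hu
    have h1 := hau u hu
    have e : ⟪-(zp + t • -zp), u⟫ = (1 - t) * ⟪-zp, u⟫ := by
      simp only [inner_neg_left, inner_add_left, real_inner_smul_left, smul_neg]; ring
    rw [e]
    nlinarith)
  intro u hu
  have h1 := hau u hu
  rw [inner_sub_right, real_inner_comm v]
  linarith

lemma proj_resid {E : Type*} [NormedAddCommGroup E] [InnerProductSpace ℝ E]
    {K : Set E} (hKcv : Convex ℝ K) (PiK : E → E)
    (hPiK : ∀ w, IsProjPt K w (PiK w)) (z v x : E) (hv : v ∈ K)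
    (h : ∀ u ∈ K, ⟪-z, u - v⟫ ≤ 0) : ‖x - PiK (x - z)‖ ≤ 2 * ‖v - x‖ := by
  set p := PiK (x - z)
  have h1 := proj_vi hKcv (hPiK (x - z)) v hv
  have h2 := h p (hPiK _).1
  have h3 : ⟪v - p, v - p⟫ ≤ ⟪v - x, v - p⟫ := by
    change ⟪x - z - p, v - p⟫ ≤ 0 at h1
    simp only [inner_sub_left, inner_sub_right, inner_neg_left] at *
    linarith
  have h4 : ‖v - p‖ ≤ ‖v - x‖ := by
    have h5 := h3.trans (real_inner_le_norm _ _)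
    rw [real_inner_self_eq_norm_sq] at h5
    by_contra hc
    push Not at hc
    nlinarith [norm_nonneg (v - x), norm_nonneg (v-p)]
  have : x - p = (v - p) - (v - x) := by abel
  rw [this]
  refine (norm_sub_le _ _).trans (by linarith)

lemma inv_sa {E : Type*} [NormedAddCommGroup E] [InnerProductSpace ℝ E] (N T : E →L[ℝ] E)
    (h₁ : N.comp T = ContinuousLinearMap.id ℝ E)
    (hN : ∀ a b : E, ⟪N a, b⟫ = ⟪a, N b⟫) (hp : ∀ a : E, 0 ≤ ⟪a, N a⟫) :
    (∀ a b : E, ⟪T a, b⟫ = ⟪a, T b⟫) ∧ (∀ a : E, 0 ≤ ⟪a, T a⟫) := by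
  have h : ∀ a, N (T a) = a := fun a => by
    have := congrArg (fun f => f a) h₁
    simpa using this
  constructor
  · intro a b
    calc ⟪T a, b⟫ = ⟪T a, N (T b)⟫ := by rw [h]
      _ = ⟪N (T a), T b⟫ := (hN _ _).symm
      _ = _ := by rw [h]
  · intro a
    have := hp (T a)
    rwa [h, real_inner_comm] at this

lemma quad_exp {E : Type*} [NormedAddCommGroup E] [InnerProductSpace ℝ E] (T : E →L[ℝ] E)
    (hT : ∀ a b : E, ⟪T a, b⟫ = ⟪a, T b⟫) (a d : E) (t : ℝ) :
    ⟪a + t • d, T (a + t • d)⟫ = ⟪a, T a⟫ + 2 * t * ⟪T a, d⟫ + t^2 * ⟪d, T d⟫ := by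
  simp only [map_add, map_smul, inner_add_left, inner_add_right, real_inner_smul_left,
    real_inner_smul_right]
  rw [← hT a d, real_inner_comm (T a) d]; ring

lemma norm_exp {E : Type*} [NormedAddCommGroup E] [InnerProductSpace ℝ E] (a d : E) (t : ℝ) :
    ‖a + t • d‖^2 = ‖a‖^2 + 2 * t * ⟪a, d⟫ + t^2 * ‖d‖^2 := by
  rw [norm_add_sq_real, real_inner_smul_right, norm_smul, mul_pow, Real.norm_eq_abs, sq_abs]
  ring

lemma quad_polar {E : Type*} [NormedAddCommGroup E] [InnerProductSpace ℝ E] (T : E →L[ℝ] E)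
    (hT : ∀ a b : E, ⟪T a, b⟫ = ⟪a, T b⟫) (a d : E) :
    2 * ⟪a, T d⟫ = ⟪a, T a⟫ - ⟪a - d, T (a - d)⟫ + ⟪d, T d⟫ := by
  simp only [map_sub, inner_sub_left, inner_sub_right]
  rw [← hT a d, real_inner_comm (T a) d]; ring

/-- smooth part of the subproblem objective -/
def Phi (σ : ℝ) (b : Y) (bb : Yb) (c : X) (cb : Xb)
    (A : X →L[ℝ] Y) (B : X →L[ℝ] Yb) (Bb : Xb →L[ℝ] Yb)
    (J : Y →L[ℝ] Y) (Jb : Yb →L[ℝ] Yb) (EA : Y →L[ℝ] Y) (Minv : Yb →L[ℝ] Yb)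
    (x0 : X) (xb0 : Xb) (z0 : X) (zb0 : Xb) (y0 : Y) (yb0 : Yb)
    (dz : X) (dzb : Xb) (dy : Y) (dyb : Yb)
    (z' : X) (zb' : Xb) (y' : Y) (yb' : Yb) : ℝ :=
  (- ⟪b, y'⟫ - ⟪bb, yb'⟫ - 1/(2*σ) * ‖x0‖^2 - 1/(2*σ) * ‖xb0‖^2
    + σ/2 * ‖adjoint A y' + adjoint B yb' + z' - c + σ⁻¹ • x0‖^2
    + σ/2 * ‖adjoint Bb yb' + zb' - cb + σ⁻¹ • xb0‖^2) +
  (σ/2 * (⟪A (z' - z0), EA (A (z' - z0))⟫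
            + ⟪Bb (zb' - zb0) + B (z' - z0) + B (adjoint A (y' - y0)),
                Minv (Bb (zb' - zb0) + B (z' - z0) + B (adjoint A (y' - y0)))⟫
            + ⟪y' - y0, J (y' - y0)⟫ + ⟪yb' - yb0, Jb (yb' - yb0)⟫)
          - (⟪dz, z'⟫ + ⟪dzb, zb'⟫ + ⟪dy, y'⟫ + ⟪dyb, yb'⟫))

lemma Phi_exp (σ : ℝ) (hσ : 0 < σ) (b : Y) (bb : Yb) (c : X) (cb : Xb)
    (A : X →L[ℝ] Y) (B : X →L[ℝ] Yb) (Bb : Xb →L[ℝ] Yb)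
    (J : Y →L[ℝ] Y) (Jb : Yb →L[ℝ] Yb) (EA : Y →L[ℝ] Y) (Minv : Yb →L[ℝ] Yb)
    (hJ : ∀ a b : Y, ⟪J a, b⟫ = ⟪a, J b⟫) (hJb : ∀ a b : Yb, ⟪Jb a, b⟫ = ⟪a, Jb b⟫)
    (hEA : ∀ a b : Y, ⟪EA a, b⟫ = ⟪a, EA b⟫) (hMi : ∀ a b : Yb, ⟪Minv a, b⟫ = ⟪a, Minv b⟫)
    (x0 : X) (xb0 : Xb) (z0 : X) (zb0 : Xb) (y0 : Y) (yb0 : Yb)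
    (δz : X) (δzb : Xb) (δy : Y) (δyb : Yb)
    (z1 : X) (zb1 : Xb) (y1 : Y) (yb1 : Yb)
    (dz : X) (dzb : Xb) (dy : Y) (dyb : Yb)
    (p : X) (hp : p = x0 + σ • (adjoint A y1 + adjoint B yb1 + z1 - c))
    (pb : Xb) (hpb : pb = xb0 + σ • (adjoint Bb yb1 + zb1 - cb))
    (e : Yb) (he : e = Bb (zb1 - zb0) + B (z1 - z0) + B (adjoint A (y1 - y0))) :
    ∃ q : ℝ, ∀ t : ℝ,
      Phi σ b bb c cb A B Bb J Jb EA Minv x0 xb0 z0 zb0 y0 yb0 δz δzb δy δyb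
        (z1 + t • dz) (zb1 + t • dzb) (y1 + t • dy) (yb1 + t • dyb) =
      Phi σ b bb c cb A B Bb J Jb EA Minv x0 xb0 z0 zb0 y0 yb0 δz δzb δy δyb z1 zb1 y1 yb1 +
      t * (⟪p + σ • (adjoint A (EA (A (z1 - z0))) + adjoint B (Minv e)) - δz, dz⟫
        + ⟪pb + σ • adjoint Bb (Minv e) - δzb, dzb⟫
        + ⟪A p + σ • (A (adjoint B (Minv e)) + J (y1 - y0)) - b - δy, dy⟫
        + ⟪B p + Bb pb + σ • Jb (yb1 - yb0) - bb - δyb, dyb⟫) + t^2 * q := by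
  refine ⟨σ/2 * ‖adjoint A dy + adjoint B dyb + dz‖^2 + σ/2 * ‖adjoint Bb dyb + dzb‖^2
    + σ/2 * (⟪A dz, EA (A dz)⟫
      + ⟪Bb dzb + B dz + B (adjoint A dy), Minv (Bb dzb + B dz + B (adjoint A dy))⟫
      + ⟪dy, J dy⟫ + ⟪dyb, Jb dyb⟫), fun t => ?_⟩
  unfold Phi
  have e1 : adjoint A (y1 + t • dy) + adjoint B (yb1 + t • dyb) + (z1 + t • dz) - c + σ⁻¹ • x0
      = σ⁻¹ • p + t • (adjoint A dy + adjoint B dyb + dz) := by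
    rw [hp, smul_add, smul_smul, inv_mul_cancel₀ hσ.ne', one_smul]
    simp only [map_add, map_smul, smul_add]; abel
  have e2 : adjoint Bb (yb1 + t • dyb) + (zb1 + t • dzb) - cb + σ⁻¹ • xb0
      = σ⁻¹ • pb + t • (adjoint Bb dyb + dzb) := by
    rw [hpb, smul_add, smul_smul, inv_mul_cancel₀ hσ.ne', one_smul]
    simp only [map_add, map_smul, smul_add]; abel
  have e1' : adjoint A y1 + adjoint B yb1 + z1 - c + σ⁻¹ • x0 = σ⁻¹ • p := by
    rw [hp, smul_add, smul_smul, inv_mul_cancel₀ hσ.ne', one_smul]; abel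
  have e2' : adjoint Bb yb1 + zb1 - cb + σ⁻¹ • xb0 = σ⁻¹ • pb := by
    rw [hpb, smul_add, smul_smul, inv_mul_cancel₀ hσ.ne', one_smul]; abel
  have e3 : A (z1 + t • dz - z0) = A (z1 - z0) + t • A dz := by
    simp only [map_add, map_smul, map_sub]; abel
  have e4 : Bb (zb1 + t • dzb - zb0) + B (z1 + t • dz - z0) + B (adjoint A (y1 + t • dy - y0))
      = e + t • (Bb dzb + B dz + B (adjoint A dy)) := by
    rw [he]
    simp only [map_add, map_smul, map_sub, smul_add]; abel
  have e5 : y1 + t • dy - y0 = (y1 - y0) + t • dy := by abel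
  have e6 : yb1 + t • dyb - yb0 = (yb1 - yb0) + t • dyb := by abel
  rw [e1, e2, e1', e2', e3, e4, e5, e6, ← he, quad_exp EA hEA, quad_exp Minv hMi,
    quad_exp J hJ, quad_exp Jb hJb, norm_exp, norm_exp]
  simp only [map_smul, inner_add_left, inner_sub_left, real_inner_smul_left, real_inner_smul_right,
    inner_add_right, ContinuousLinearMap.adjoint_inner_left, ContinuousLinearMap.adjoint_inner_right]
  have s1 : ∀ w : Y, ⟪A (adjoint B (Minv e)), w⟫ = ⟪Minv e, B (adjoint A w)⟫ := by
    intro w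
    rw [← ContinuousLinearMap.adjoint_inner_right, ContinuousLinearMap.adjoint_inner_left]
  rw [s1]
  have hi : σ * σ⁻¹ = 1 := mul_inv_cancel₀ hσ.ne'
  linear_combination (t * (⟪A p, dy⟫ + ⟪B p, dyb⟫ + ⟪p, dz⟫ + ⟪Bb pb, dyb⟫ + ⟪pb, dzb⟫)) * hi

/-- the quadratic energy -/
def Qf (A : X →L[ℝ] Y) (B : X →L[ℝ] Yb) (Bb : Xb →L[ℝ] Yb)
    (J : Y →L[ℝ] Y) (Jb : Yb →L[ℝ] Yb) (EA : Y →L[ℝ] Y) (Minv : Yb →L[ℝ] Yb)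
    (a s g : ℝ) (u : Y × Yb × X × Xb × X × Xb) : ℝ :=
  a * (‖u.2.2.2.2.1‖^2 + ‖u.2.2.2.2.2‖^2)
  + s * (⟪A u.2.2.1, EA (A u.2.2.1)⟫
    + ⟪Bb u.2.2.2.1 + B u.2.2.1 + B (adjoint A u.1),
        Minv (Bb u.2.2.2.1 + B u.2.2.1 + B (adjoint A u.1))⟫
    + ⟪u.1, J u.1⟫ + ⟪u.2.1, Jb u.2.1⟫)
  + g * (‖adjoint A u.1 + adjoint B u.2.1 + u.2.2.1‖^2 + ‖adjoint Bb u.2.1 + u.2.2.2.1‖^2)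

lemma Qf_bounds (A : X →L[ℝ] Y) (B : X →L[ℝ] Yb) (Bb : Xb →L[ℝ] Yb)
    (J : Y →L[ℝ] Y) (Jb : Yb →L[ℝ] Yb) (EA : Y →L[ℝ] Y) (Minv : Yb →L[ℝ] Yb)
    (a s g : ℝ) (ha : 0 < a) (hs : 0 < s) (hg : 0 < g)
    (hJ : ∀ w : Y, 0 ≤ ⟪w, J w⟫) (hJb : ∀ w : Yb, 0 ≤ ⟪w, Jb w⟫)
    (hEA : ∀ w : Y, 0 ≤ ⟪w, EA w⟫) (hMi : ∀ w : Yb, 0 ≤ ⟪w, Minv w⟫)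
    (hEA0 : ∀ w : Y, ⟪w, EA w⟫ = 0 → w = 0) (hMi0 : ∀ w : Yb, ⟪w, Minv w⟫ = 0 → w = 0)
    (hD1 : ∀ y : Y, y ≠ 0 → 0 < ⟪y, A (adjoint A y) + J y⟫)
    (hD2 : ∀ w : Yb, w ≠ 0 → 0 < ⟪w, B (adjoint B w) + Bb (adjoint Bb w) + Jb w⟫) :
    ∃ m M : ℝ, 0 < m ∧ 0 < M ∧ ∀ v, m * ‖v‖^2 ≤ Qf A B Bb J Jb EA Minv a s g v ∧
      Qf A B Bb J Jb EA Minv a s g v ≤ M * ‖v‖^2 := by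
  apply form_bounds
  · unfold Qf
    fun_prop
  · intro t u
    have e : Bb (t • u.2.2.2.1) + B (t • u.2.2.1) + B (adjoint A (t • u.1))
        = t • (Bb u.2.2.2.1 + B u.2.2.1 + B (adjoint A u.1)) := by
      simp only [map_smul, smul_add]
    have e1 : adjoint A (t • u.1) + adjoint B (t • u.2.1) + t • u.2.2.1
        = t • (adjoint A u.1 + adjoint B u.2.1 + u.2.2.1) := by
      simp only [map_smul, smul_add]
    have e2 : adjoint Bb (t • u.2.1) + t • u.2.2.2.1
        = t • (adjoint Bb u.2.1 + u.2.2.2.1) := by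
      simp only [map_smul, smul_add]
    unfold Qf
    simp only [Prod.smul_fst, Prod.smul_snd]
    rw [e, e1, e2]
    simp only [map_smul, real_inner_smul_left, real_inner_smul_right, norm_smul, mul_pow,
      Real.norm_eq_abs, sq_abs]
    ring
  · rintro ⟨y, yb, z, zb, x, xb⟩ hu
    by_contra hneg
    apply hu
    unfold Qf at hneg
    simp only [not_lt] at hneg
    set e := Bb zb + B z + B (adjoint A y) with he
    set r := adjoint A y + adjoint B yb + z with hr
    set rb := adjoint Bb yb + zb with hrb
    have p1 := hEA (A z)
    have p2 := hMi e
    have p3 := hJ y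
    have p4 := hJb yb
    have p5 := sq_nonneg ‖x‖
    have p6 := sq_nonneg ‖xb‖
    have p7 := sq_nonneg ‖r‖
    have p8 := sq_nonneg ‖rb‖
    have q1 : 0 ≤ a * (‖x‖^2 + ‖xb‖^2) := by positivity
    have q2 : 0 ≤ s * (⟪A z, EA (A z)⟫ + ⟪e, Minv e⟫ + ⟪y, J y⟫ + ⟪yb, Jb yb⟫) := by positivity
    have q3 : 0 ≤ g * (‖r‖^2 + ‖rb‖^2) := by positivity
    have z1 : ‖x‖^2 + ‖xb‖^2 = 0 := by
      have : a * (‖x‖^2 + ‖xb‖^2) = 0 := by linarith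
      exact (mul_eq_zero.1 this).resolve_left ha.ne'
    have z2 : ⟪A z, EA (A z)⟫ + ⟪e, Minv e⟫ + ⟪y, J y⟫ + ⟪yb, Jb yb⟫ = 0 := by
      have : s * (⟪A z, EA (A z)⟫ + ⟪e, Minv e⟫ + ⟪y, J y⟫ + ⟪yb, Jb yb⟫) = 0 := by linarith
      exact (mul_eq_zero.1 this).resolve_left hs.ne'
    have z3 : ‖r‖^2 + ‖rb‖^2 = 0 := by
      have : g * (‖r‖^2 + ‖rb‖^2) = 0 := by linarith
      exact (mul_eq_zero.1 this).resolve_left hg.ne'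
    have x0 : x = 0 := by
      have : ‖x‖^2 = 0 := by linarith
      simpa using this
    have xb0 : xb = 0 := by
      have : ‖xb‖^2 = 0 := by linarith
      simpa using this
    have r0 : r = 0 := by
      have : ‖r‖^2 = 0 := by linarith
      simpa using this
    have rb0 : rb = 0 := by
      have : ‖rb‖^2 = 0 := by linarith
      simpa using this
    have Az0 : A z = 0 := hEA0 _ (by linarith)
    have e0 : e = 0 := hMi0 _ (by linarith)
    have J0 : ⟪y, J y⟫ = 0 := by linarith
    have Jb0 : ⟪yb, Jb yb⟫ = 0 := by linarith
    have zz : z = -adjoint A y - adjoint B yb := by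
      rw [eq_sub_iff_add_eq, eq_neg_iff_add_eq_zero, ← r0, hr]; abel
    have zzb : zb = - adjoint Bb yb := by
      rw [eq_neg_iff_add_eq_zero, ← rb0, hrb]; abel
    have yb0 : yb = 0 := by
      by_contra hne
      have h1 := hD2 yb hne
      have h2 : B (adjoint B yb) + Bb (adjoint Bb yb) = -e := by
        rw [he, zz, zzb]; simp only [map_sub, map_neg]; abel
      rw [h2, e0, inner_add_right, Jb0] at h1
      simp at h1
    have y0 : y = 0 := by
      by_contra hne
      have h1 := hD1 y hne
      have h2 : A (adjoint A y) = - A z := by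
        rw [zz, yb0]; simp
      rw [h2, Az0, inner_add_right, J0] at h1
      simp at h1
    have zb0 : zb = 0 := by rw [zzb, yb0]; simp
    have z0 : z = 0 := by rw [zz, yb0, y0]; simp
    simp [x0, xb0, yb0, y0, zb0, z0]

lemma energy (σ τ : ℝ) (hσ : 0 < σ) (hτ : 0 < τ) (hτ2 : τ < 2)
    (A : X →L[ℝ] Y) (B : X →L[ℝ] Yb) (Bb : Xb →L[ℝ] Yb)
    (J : Y →L[ℝ] Y) (Jb : Yb →L[ℝ] Yb) (EA : Y →L[ℝ] Y) (Minv : Yb →L[ℝ] Yb)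
    (hJ : ∀ a b : Y, ⟪J a, b⟫ = ⟪a, J b⟫) (hJb : ∀ a b : Yb, ⟪Jb a, b⟫ = ⟪a, Jb b⟫)
    (hEA : ∀ a b : Y, ⟪EA a, b⟫ = ⟪a, EA b⟫) (hMi : ∀ a b : Yb, ⟪Minv a, b⟫ = ⟪a, Minv b⟫)
    (ay : Y) (ayb : Yb) (az : X) (azb : Xb) (dy : Y) (dyb : Yb) (dz : X) (dzb : Xb)
    (x0 : X) (xb0 : Xb) (δz : X) (δzb : Xb) (δy : Y) (δyb : Yb)
    (r : X) (hr : r = adjoint A ay + adjoint B ayb + az)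
    (rb : Xb) (hrb : rb = adjoint Bb ayb + azb)
    (e : Yb) (he : e = Bb dzb + B dz + B (adjoint A dy))
    (hz : ⟪az, x0 + σ • r + σ • (adjoint A (EA (A dz)) + adjoint B (Minv e)) - δz⟫ ≤ 0)
    (hzb : ⟪azb, xb0 + σ • rb + σ • adjoint Bb (Minv e) - δzb⟫ ≤ 0)
    (hy : A (x0 + σ • r) + σ • (A (adjoint B (Minv e)) + J dy) - δy = 0)
    (hyb : B (x0 + σ • r) + Bb (xb0 + σ • rb) + σ • Jb dyb - δyb = 0) :
    Qf A B Bb J Jb EA Minv (1/(2*τ*σ)) (σ/2) ((2-τ)*σ/8)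
      (ay, ayb, az, azb, x0 + (τ*σ) • r, xb0 + (τ*σ) • rb) ≤
    Qf A B Bb J Jb EA Minv (1/(2*τ*σ)) (σ/2) ((2-τ)*σ/8)
      (ay - dy, ayb - dyb, az - dz, azb - dzb, x0, xb0)
    - Qf A B Bb J Jb EA Minv ((2-τ)*σ/8/(τ*σ)^2) (σ/2) ((2-τ)*σ/8/2)
      (dy, dyb, dz, dzb, (τ*σ) • r, (τ*σ) • rb)
    + (⟪δz, az⟫ + ⟪δzb, azb⟫ + ⟪δy, ay⟫ + ⟪δyb, ayb⟫) := by
  have hy' := congrArg (fun w => ⟪ay, w⟫) hy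
  have hyb' := congrArg (fun w => ⟪ayb, w⟫) hyb
  -- the bilinear form
  set ea := Bb azb + B az + B (adjoint A ay) with hea
  have I1 : ⟪r, x0 + σ • r⟫ + ⟪rb, xb0 + σ • rb⟫ + σ * (⟪A az, EA (A dz)⟫ + ⟪ea, Minv e⟫
      + ⟪ay, J dy⟫ + ⟪ayb, Jb dyb⟫) ≤ ⟪δz, az⟫ + ⟪δzb, azb⟫ + ⟪δy, ay⟫ + ⟪δyb, ayb⟫ := by
    set p := x0 + σ • r
    set pb := xb0 + σ • rb
    have t1 : ⟪r, p⟫ = ⟪ay, A p⟫ + ⟪ayb, B p⟫ + ⟪az, p⟫ := by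
      rw [hr]
      simp only [inner_add_left, ContinuousLinearMap.adjoint_inner_left]
    have t2 : ⟪rb, pb⟫ = ⟪ayb, Bb pb⟫ + ⟪azb, pb⟫ := by
      rw [hrb]
      simp only [inner_add_left, ContinuousLinearMap.adjoint_inner_left]
    have t3 : ⟪ea, Minv e⟫ = ⟪Bb azb, Minv e⟫ + ⟪B az, Minv e⟫ + ⟪B (adjoint A ay), Minv e⟫ := by
      rw [hea]
      simp only [inner_add_left]
    have t4 : ⟪ay, A (adjoint B (Minv e))⟫ = ⟪B (adjoint A ay), Minv e⟫ := by
      rw [← ContinuousLinearMap.adjoint_inner_left, ContinuousLinearMap.adjoint_inner_right]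
    simp only [inner_add_right, inner_sub_right, real_inner_smul_right, inner_zero_right,
      ContinuousLinearMap.adjoint_inner_right, t4] at hz hzb hy' hyb'
    rw [t1, t2, t3, real_inner_comm az δz, real_inner_comm azb δzb, real_inner_comm ay δy,
      real_inner_comm ayb δyb]
    linarith
  have f1 := quad_polar EA hEA (A az) (A dz)
  have f2 := quad_polar Minv hMi ea e
  have f3 := quad_polar J hJ ay dy
  have f4 := quad_polar Jb hJb ayb dyb
  have g1 : Bb (azb - dzb) + B (az - dz) + B (adjoint A (ay - dy)) = ea - e := by
    rw [hea, he]; simp only [map_sub]; abel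
  set r0 := adjoint A (ay - dy) + adjoint B (ayb - dyb) + (az - dz) with hr0
  set rb0 := adjoint Bb (ayb - dyb) + (azb - dzb) with hrb0
  have g2 : adjoint A dy + adjoint B dyb + dz = r - r0 := by
    rw [hr, hr0]; simp only [map_sub]; abel
  have g3 : adjoint Bb dyb + dzb = rb - rb0 := by
    rw [hrb, hrb0]; simp only [map_sub]; abel
  have n1 : ‖r - r0‖^2 ≤ 2 * ‖r‖^2 + 2 * ‖r0‖^2 := by
    have := parallelogram_law_with_norm ℝ r r0
    nlinarith [sq_nonneg ‖r + r0‖]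
  have n2 : ‖rb - rb0‖^2 ≤ 2 * ‖rb‖^2 + 2 * ‖rb0‖^2 := by
    have := parallelogram_law_with_norm ℝ rb rb0
    nlinarith [sq_nonneg ‖rb + rb0‖]
  unfold Qf
  simp only
  rw [g1, ← hea, ← he, ← hr, ← hrb, ← hr0, ← hrb0, g2, g3, map_sub A, norm_exp, norm_exp,
    norm_smul, norm_smul]
  have k1 : 1/(2*τ*σ) * (‖x0‖^2 + 2*(τ*σ) * ⟪x0, r⟫ + (τ*σ)^2*‖r‖^2
      + (‖xb0‖^2 + 2*(τ*σ) * ⟪xb0, rb⟫ + (τ*σ)^2*‖rb‖^2)) =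
      1/(2*τ*σ) * (‖x0‖^2 + ‖xb0‖^2) + (⟪x0, r⟫ + ⟪xb0, rb⟫) + τ*σ/2 * (‖r‖^2 + ‖rb‖^2) := by
    field_simp; ring
  have k2 : (2-τ)*σ/8/(τ*σ)^2 * ((‖τ*σ‖ * ‖r‖)^2 + (‖τ*σ‖ * ‖rb‖)^2)
      = (2-τ)*σ/8 * (‖r‖^2 + ‖rb‖^2) := by
    rw [mul_pow, mul_pow, Real.norm_eq_abs, sq_abs]; field_simp; rw [sq_abs]; ring
  rw [k1, k2]
  rw [inner_add_right, inner_add_right, real_inner_smul_right, real_inner_smul_right,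
    real_inner_self_eq_norm_sq, real_inner_self_eq_norm_sq, real_inner_comm x0 r,
    real_inner_comm xb0 rb] at I1
  set g := (2-τ)*σ/8 with hg
  have hg0 : 0 < g := by
    have : 0 < 2 - τ := by linarith
    positivity
  have n3 : g/2 * (‖r - r0‖^2 + ‖rb - rb0‖^2) ≤ g/2 * (2 * ‖r‖^2 + 2 * ‖r0‖^2 +
      (2 * ‖rb‖^2 + 2 * ‖rb0‖^2)) := mul_le_mul_of_nonneg_left (by linarith) (by positivity)
  have hg' : τ * σ / 2 = σ - 4 * g := by rw [hg]; ring
  rw [hg']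
  have f : σ/2 * (⟪A az - A dz, EA (A az - A dz)⟫ + ⟪ea - e, Minv (ea - e)⟫
      + ⟪ay - dy, J (ay - dy)⟫ + ⟪ayb - dyb, Jb (ayb - dyb)⟫) =
    σ/2 * (⟪A az, EA (A az)⟫ + ⟪ea, Minv ea⟫ + ⟪ay, J ay⟫ + ⟪ayb, Jb ayb⟫)
    + σ/2 * (⟪A dz, EA (A dz)⟫ + ⟪e, Minv e⟫ + ⟪dy, J dy⟫ + ⟪dyb, Jb dyb⟫)
    - σ * (⟪A az, EA (A dz)⟫ + ⟪ea, Minv e⟫ + ⟪ay, J dy⟫ + ⟪ayb, Jb dyb⟫) := by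
    linear_combination (σ/2) * (f1 + f2 + f3 + f4)
  rw [f]
  have n4 : 0 ≤ g * (‖r‖^2 + ‖rb‖^2) := by positivity
  linarith

lemma step_opt (σ : ℝ) (hσ : 0 < σ) (K : Set X) (hKne : K.Nonempty) (hKcv : Convex ℝ K)
    (Kb : Set Xb) (hKbne : Kb.Nonempty) (hKbcv : Convex ℝ Kb)
    (PiK : X → X) (hPiK : ∀ w, IsProjPt K w (PiK w))
    (PiKb : Xb → Xb) (hPiKb : ∀ w, IsProjPt Kb w (PiKb w))
    (b : Y) (bb : Yb) (c : X) (cb : Xb)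
    (A : X →L[ℝ] Y) (B : X →L[ℝ] Yb) (Bb : Xb →L[ℝ] Yb)
    (J : Y →L[ℝ] Y) (Jb : Yb →L[ℝ] Yb) (EA : Y →L[ℝ] Y) (Minv : Yb →L[ℝ] Yb)
    (hJ : ∀ a b : Y, ⟪J a, b⟫ = ⟪a, J b⟫) (hJb : ∀ a b : Yb, ⟪Jb a, b⟫ = ⟪a, Jb b⟫)
    (hEA : ∀ a b : Y, ⟪EA a, b⟫ = ⟪a, EA b⟫) (hMi : ∀ a b : Yb, ⟪Minv a, b⟫ = ⟪a, Minv b⟫)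
    (x0 : X) (xb0 : Xb) (z0 : X) (zb0 : Xb) (y0 : Y) (yb0 : Yb)
    (δz : X) (δzb : Xb) (δy : Y) (δyb : Yb)
    (z1 : X) (zb1 : Xb) (y1 : Y) (yb1 : Yb)
    (p : X) (hp : p = x0 + σ • (adjoint A y1 + adjoint B yb1 + z1 - c))
    (pb : Xb) (hpb : pb = xb0 + σ • (adjoint Bb yb1 + zb1 - cb))
    (e : Yb) (he : e = Bb (zb1 - zb0) + B (z1 - z0) + B (adjoint A (y1 - y0)))
    (zh : X) (zbh : Xb) (hzh : conjFn (indE K) (-zh) ≠ ⊤) (hzbh : conjFn (indE Kb) (-zbh) ≠ ⊤)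
    (H : ∀ (z' : X) (zb' : Xb) (y' : Y) (yb' : Yb),
      conjFn (indE K) (-z1) + conjFn (indE Kb) (-zb1) +
        (Phi σ b bb c cb A B Bb J Jb EA Minv x0 xb0 z0 zb0 y0 yb0 δz δzb δy δyb z1 zb1 y1 yb1
          : EReal) ≤
      conjFn (indE K) (-z') + conjFn (indE Kb) (-zb') +
        (Phi σ b bb c cb A B Bb J Jb EA Minv x0 xb0 z0 zb0 y0 yb0 δz δzb δy δyb z' zb' y' yb'
          : EReal)) :
    (p + σ • (adjoint A (EA (A (z1 - z0))) + adjoint B (Minv e)) - δz ∈ K ∧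
      ∀ u ∈ K, ⟪-z1, u - (p + σ • (adjoint A (EA (A (z1 - z0))) + adjoint B (Minv e)) - δz)⟫ ≤ 0) ∧
    (pb + σ • adjoint Bb (Minv e) - δzb ∈ Kb ∧
      ∀ u ∈ Kb, ⟪-zb1, u - (pb + σ • adjoint Bb (Minv e) - δzb)⟫ ≤ 0) ∧
    A p + σ • (A (adjoint B (Minv e)) + J (y1 - y0)) - b - δy = 0 ∧
    B p + Bb pb + σ • Jb (yb1 - yb0) - bb - δyb = 0 := by
  have nb1 := conj_ne_bot hKne (-z1)
  have nb2 := conj_ne_bot hKbne (-zb1)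
  have hfin : conjFn (indE K) (-z1) ≠ ⊤ ∧ conjFn (indE Kb) (-zb1) ≠ ⊤ := by
    have h1 := H zh zbh y0 yb0
    have h2 : conjFn (indE K) (-z1) + conjFn (indE Kb) (-zb1) ≠ ⊤ := by
      intro h
      rw [h, EReal.top_add_coe, top_le_iff] at h1
      lift conjFn (indE K) (-zh) to ℝ using ⟨hzh, conj_ne_bot hKne _⟩ with a1
      lift conjFn (indE Kb) (-zbh) to ℝ using ⟨hzbh, conj_ne_bot hKbne _⟩ with a2
      rw [← EReal.coe_add, ← EReal.coe_add] at h1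
      exact EReal.coe_ne_top _ h1
    constructor
    · intro h
      exact h2 (by rw [h, EReal.top_add_of_ne_bot nb2])
    · intro h
      exact h2 (by rw [h, EReal.add_top_of_ne_bot nb1])
  obtain ⟨a1, ha1⟩ : ∃ a : ℝ, conjFn (indE K) (-z1) = (a : EReal) :=
    ⟨_, (EReal.coe_toReal hfin.1 nb1).symm⟩
  obtain ⟨a2, ha2⟩ : ∃ a : ℝ, conjFn (indE Kb) (-zb1) = (a : EReal) :=
    ⟨_, (EReal.coe_toReal hfin.2 nb2).symm⟩
  have ex := Phi_exp σ hσ b bb c cb A B Bb J Jb EA Minv hJ hJb hEA hMi x0 xb0 z0 zb0 y0 yb0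
    δz δzb δy δyb z1 zb1 y1 yb1
  refine ⟨?_, ?_, ?_, ?_⟩
  · apply prox_block hKne hKcv PiK hPiK z1 _ hfin.1
    intro d
    obtain ⟨q, hq⟩ := ex d 0 0 0 p hp pb hpb e he
    refine ⟨q, fun t t0 t1 => ?_⟩
    have h1 := H (z1 + t • d) (zb1 + t • 0) (y1 + t • 0) (yb1 + t • 0)
    rw [hq t] at h1
    simp only [smul_zero, add_zero, inner_zero_right] at h1
    by_cases htop : conjFn (indE K) (-(z1 + t • d)) = ⊤
    · rw [htop, EReal.top_add_coe]; exact le_top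
    obtain ⟨a3, ha3⟩ : ∃ a : ℝ, conjFn (indE K) (-(z1 + t • d)) = (a : EReal) :=
      ⟨_, (EReal.coe_toReal htop (conj_ne_bot hKne _)).symm⟩
    rw [ha1, ha2, ha3] at h1
    rw [ha1, ha3]
    norm_cast at h1 ⊢
    linarith
  · apply prox_block hKbne hKbcv PiKb hPiKb zb1 _ hfin.2
    intro d
    obtain ⟨q, hq⟩ := ex 0 d 0 0 p hp pb hpb e he
    refine ⟨q, fun t t0 t1 => ?_⟩
    have h1 := H (z1 + t • 0) (zb1 + t • d) (y1 + t • 0) (yb1 + t • 0)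
    rw [hq t] at h1
    simp only [smul_zero, add_zero, zero_add, inner_zero_right] at h1
    by_cases htop : conjFn (indE Kb) (-(zb1 + t • d)) = ⊤
    · rw [htop, EReal.top_add_coe]; exact le_top
    obtain ⟨a3, ha3⟩ : ∃ a : ℝ, conjFn (indE Kb) (-(zb1 + t • d)) = (a : EReal) :=
      ⟨_, (EReal.coe_toReal htop (conj_ne_bot hKbne _)).symm⟩
    rw [ha1, ha2, ha3] at h1
    rw [ha2, ha3]
    norm_cast at h1 ⊢
    linarith
  · set G := A p + σ • (A (adjoint B (Minv e)) + J (y1 - y0)) - b - δy with hG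
    obtain ⟨q, hq⟩ := ex 0 0 (-G) 0 p hp pb hpb e he
    have := lin_nonneg (a := ⟪G, -G⟫) (c := q) (by
      intro t t0 t1
      have h1 := H (z1 + t • 0) (zb1 + t • 0) (y1 + t • (-G)) (yb1 + t • 0)
      rw [hq t] at h1
      simp only [smul_zero, add_zero, zero_add, inner_zero_right] at h1
      rw [ha1, ha2] at h1
      norm_cast at h1
      linarith)
    rw [inner_neg_right] at this
    exact real_inner_self_nonpos.1 (by linarith)
  · set G := B p + Bb pb + σ • Jb (yb1 - yb0) - bb - δyb with hG
    obtain ⟨q, hq⟩ := ex 0 0 0 (-G) p hp pb hpb e he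
    have := lin_nonneg (a := ⟪G, -G⟫) (c := q) (by
      intro t t0 t1
      have h1 := H (z1 + t • 0) (zb1 + t • 0) (y1 + t • 0) (yb1 + t • (-G))
      rw [hq t] at h1
      simp only [smul_zero, add_zero, zero_add, inner_zero_right] at h1
      rw [ha1, ha2] at h1
      norm_cast at h1
      linarith)
    rw [inner_neg_right] at this
    exact real_inner_self_nonpos.1 (by linarith)

lemma hom1_bound {E : Type*} [NormedAddCommGroup E] [NormedSpace ℝ E] [FiniteDimensional ℝ E]
    (f : E → ℝ) (hc : Continuous f) (hh : ∀ (t : ℝ) v, f (t • v) = |t| * f v) :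
    ∃ C : ℝ, 0 < C ∧ ∀ v, f v ≤ C * ‖v‖ := by
  have : ProperSpace E := FiniteDimensional.proper ℝ E
  have hcomp : IsCompact (Metric.sphere (0:E) 1) := isCompact_sphere 0 1
  obtain ⟨M, hM⟩ := hcomp.bddAbove_image hc.continuousOn
  refine ⟨max M 1, lt_of_lt_of_le one_pos (le_max_right _ _), ?_⟩
  intro v
  by_cases hv : v = 0
  · have : f v = 0 := by
      have := hh 0 v
      simpa [hv] using this
    rw [this]; simp [hv]
  · have hn : 0 < ‖v‖ := norm_pos_iff.2 hv
    have hs : ‖v‖⁻¹ • v ∈ Metric.sphere (0:E) 1 := by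
      simp [norm_smul, hn.ne']
    have e : f v = ‖v‖ * f (‖v‖⁻¹ • v) := by
      rw [hh, abs_of_pos (inv_pos.2 hn)]; field_simp
    have h2 : f (‖v‖⁻¹ • v) ≤ max M 1 := le_trans (hM ⟨_, hs, rfl⟩) (le_max_left _ _)
    rw [e, mul_comm]
    exact mul_le_mul_of_nonneg_right h2 hn.le

lemma resid_const (σ τ : ℝ) (A : X →L[ℝ] Y) (B : X →L[ℝ] Yb) (Bb : Xb →L[ℝ] Yb)
    (J : Y →L[ℝ] Y) (Jb : Yb →L[ℝ] Yb) (EA : Y →L[ℝ] Y) (Minv : Yb →L[ℝ] Yb) (κ : ℝ) :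
    ∃ C : ℝ, 0 < C ∧ ∀ (dy : Y) (dyb : Yb) (dz : X) (dzb : Xb) (dx : X) (dxb : Xb) (e : Yb),
      e = Bb dzb + B dz + B (adjoint A dy) →
      ‖κ • A dx + σ • (A (adjoint B (Minv e)) + J dy)‖
      + ‖κ • (B dx + Bb dxb) + σ • Jb dyb‖
      + ‖(τ*σ)⁻¹ • dx‖ + ‖(τ*σ)⁻¹ • dxb‖
      + 2 * ‖κ • dx + σ • (adjoint A (EA (A dz)) + adjoint B (Minv e))‖
      + 2 * ‖κ • dxb + σ • adjoint Bb (Minv e)‖ ≤ C * ‖(dy, dyb, dz, dzb, dx, dxb)‖ := by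
  let ee : Y × Yb × X × Xb × X × Xb → Yb := fun u => Bb u.2.2.2.1 + B u.2.2.1 + B (adjoint A u.1)
  have hee : Continuous ee := by fun_prop
  have hes : ∀ (t : ℝ) u, ee (t • u) = t • ee u := by
    intro t u
    simp only [ee, Prod.smul_fst, Prod.smul_snd, map_smul, smul_add]
  obtain ⟨C, C0, hC⟩ := hom1_bound (E := Y × Yb × X × Xb × X × Xb) (fun u =>
      ‖κ • A u.2.2.2.2.1 + σ • (A (adjoint B (Minv (ee u))) + J u.1)‖
      + ‖κ • (B u.2.2.2.2.1 + Bb u.2.2.2.2.2) + σ • Jb u.2.1‖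
      + ‖(τ*σ)⁻¹ • u.2.2.2.2.1‖ + ‖(τ*σ)⁻¹ • u.2.2.2.2.2‖
      + 2 * ‖κ • u.2.2.2.2.1 + σ • (adjoint A (EA (A u.2.2.1)) + adjoint B (Minv (ee u)))‖
      + 2 * ‖κ • u.2.2.2.2.2 + σ • adjoint Bb (Minv (ee u))‖) (by fun_prop) (by
    intro t u
    simp only [hes, Prod.smul_fst, Prod.smul_snd, map_smul]
    simp only [← smul_add, smul_comm _ t, norm_smul t, Real.norm_eq_abs]
    ring)
  refine ⟨C, C0, ?_⟩
  intro dy dyb dz dzb dx dxb e he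
  have := hC (dy, dyb, dz, dzb, dx, dxb)
  simpa only [ee, ← he] using this

lemma sqrt_dist_bounds (y1 : Y) (yb1 : Yb) (z1 : X) (zb1 : Xb) (x1 : X) (xb1 : Xb)
    (y2 : Y) (yb2 : Yb) (z2 : X) (zb2 : Xb) (x2 : X) (xb2 : Xb) :
    Real.sqrt (distSq6 y1 yb1 z1 zb1 x1 xb1 y2 yb2 z2 zb2 x2 xb2) ≤
      3 * ‖((y1, yb1, z1, zb1, x1, xb1) : Y × Yb × X × Xb × X × Xb)
        - (y2, yb2, z2, zb2, x2, xb2)‖ ∧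
    ‖((y1, yb1, z1, zb1, x1, xb1) : Y × Yb × X × Xb × X × Xb)
        - (y2, yb2, z2, zb2, x2, xb2)‖ ≤
      Real.sqrt (distSq6 y1 yb1 z1 zb1 x1 xb1 y2 yb2 z2 zb2 x2 xb2) := by
  unfold distSq6
  simp only [Prod.mk_sub_mk]
  set a := y1 - y2
  set b := yb1 - yb2
  set c := z1 - z2
  set d := zb1 - zb2
  set e := x1 - x2
  set f := xb1 - xb2
  have hm : ∀ n : ℝ, ‖(a, b, c, d, e, f)‖ ≤ n ↔
      ‖a‖ ≤ n ∧ ‖b‖ ≤ n ∧ ‖c‖ ≤ n ∧ ‖d‖ ≤ n ∧ ‖e‖ ≤ n ∧ ‖f‖ ≤ n := by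
    intro n
    simp only [Prod.norm_mk, sup_le_iff]
  constructor
  · obtain ⟨h1, h2, h3, h4, h5, h6⟩ := (hm _).1 le_rfl
    set n := ‖(a, b, c, d, e, f)‖
    have n0 : 0 ≤ n := (norm_nonneg a).trans h1
    apply Real.sqrt_le_iff.2 ⟨by positivity, ?_⟩
    have q : ∀ s : ℝ, 0 ≤ s → s ≤ n → s^2 ≤ n^2 := fun s h h' => by gcongr
    have := q _ (norm_nonneg a) h1
    have := q _ (norm_nonneg b) h2
    have := q _ (norm_nonneg c) h3
    have := q _ (norm_nonneg d) h4
    have := q _ (norm_nonneg e) h5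
    have := q _ (norm_nonneg f) h6
    nlinarith
  · rw [hm]
    have := sq_nonneg ‖a‖
    have := sq_nonneg ‖b‖
    have := sq_nonneg ‖c‖
    have := sq_nonneg ‖d‖
    have := sq_nonneg ‖e‖
    have := sq_nonneg ‖f‖
    refine ⟨?_, ?_, ?_, ?_, ?_, ?_⟩ <;> apply Real.le_sqrt_of_sq_le <;> linarith

lemma sqrt_sum_le (a b c d e f : ℝ) (ha : 0 ≤ a) (hb : 0 ≤ b) (hc : 0 ≤ c) (hd : 0 ≤ d)
    (he : 0 ≤ e) (hf : 0 ≤ f) :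
    Real.sqrt (a^2 + b^2 + c^2 + d^2 + e^2 + f^2) ≤ a + b + c + d + e + f := by
  apply Real.sqrt_le_iff.2 ⟨by positivity, ?_⟩
  have : (a + b + c + d + e + f)^2 = a^2 + b^2 + c^2 + d^2 + e^2 + f^2
    + 2 * (a*b + a*c + a*d + a*e + a*f + b*c + b*d + b*e + b*f + c*d + c*e + c*f
      + d*e + d*f + e*f) := by ring
  rw [this]
  have : 0 ≤ a*b + a*c + a*d + a*e + a*f + b*c + b*d + b*e + b*f + c*d + c*e + c*f
      + d*e + d*f + e*f := by positivity
  linarith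


set_option maxHeartbeats 2000000 in
theorem DBA_sGS_ALM_local_linear_convergence
    (σ : ℝ) (hσ : 0 < σ)
    (τ : ℝ) (hτ : τ ∈ Set.Ioo (0 : ℝ) 2)
    (K : Set X) (hKne : K.Nonempty) (hKcl : IsClosed K) (hKcv : Convex ℝ K)
    (Kb : Set Xb) (hKbne : Kb.Nonempty) (hKbcl : IsClosed Kb) (hKbcv : Convex ℝ Kb)
    (b : Y) (bb : Yb) (c : X) (cb : Xb)
    (A : X →L[ℝ] Y) (B : X →L[ℝ] Yb) (Bb : Xb →L[ℝ] Yb)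
    (J : Y →L[ℝ] Y) (hJsa : adjoint J = J) (hJpsd : ∀ y : Y, 0 ≤ ⟪y, J y⟫)
    (Jb : Yb →L[ℝ] Yb) (hJbsa : adjoint Jb = Jb) (hJbpsd : ∀ w : Yb, 0 ≤ ⟪w, Jb w⟫)
    (hDμpd : ∀ y : Y, y ≠ 0 → 0 < ⟪y, A (adjoint A y) + J y⟫)
    (M : Yb →L[ℝ] Yb) (hM : M = B.comp (adjoint B) + Bb.comp (adjoint Bb) + Jb)
    (hDνpd : ∀ w : Yb, w ≠ 0 → 0 < ⟪w, M w⟫)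
    (EA : Y →L[ℝ] Y)
    (hEA₁ : (A.comp (adjoint A) + J).comp EA = ContinuousLinearMap.id ℝ Y)
    (hEA₂ : EA.comp (A.comp (adjoint A) + J) = ContinuousLinearMap.id ℝ Y)
    (Minv : Yb →L[ℝ] Yb)
    (hMinv₁ : M.comp Minv = ContinuousLinearMap.id ℝ Yb)
    (hMinv₂ : Minv.comp M = ContinuousLinearMap.id ℝ Yb)
    -- projections onto K and K̄ (with their defining properties)
    (PiK : X → X) (hPiK : ∀ w, IsProjPt K w (PiK w))
    (PiKb : Xb → Xb) (hPiKb : ∀ w, IsProjPt Kb w (PiKb w))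
    -- the sequences generated by DBA-sGS-ALM with perturbation vectors Δ^k
    (z : ℕ → X) (zb : ℕ → Xb) (y : ℕ → Y) (yb : ℕ → Yb) (x : ℕ → X) (xb : ℕ → Xb)
    (Δz : ℕ → X) (Δzb : ℕ → Xb) (Δy : ℕ → Y) (Δyb : ℕ → Yb)
    (hstep1 : ∀ k, ∀ (z' : X) (zb' : Xb) (y' : Y) (yb' : Yb),
      LsigALM σ K Kb b bb c cb A B Bb (z (k+1)) (zb (k+1)) (y (k+1)) (yb (k+1))
          (x k) (xb k) +
        ((σ/2 * (⟪A (z (k+1) - z k), EA (A (z (k+1) - z k))⟫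
            + ⟪Bb (zb (k+1) - zb k) + B (z (k+1) - z k) + B (adjoint A (y (k+1) - y k)),
                Minv (Bb (zb (k+1) - zb k) + B (z (k+1) - z k)
                  + B (adjoint A (y (k+1) - y k)))⟫
            + ⟪y (k+1) - y k, J (y (k+1) - y k)⟫
            + ⟪yb (k+1) - yb k, Jb (yb (k+1) - yb k)⟫)
          - (⟪Δz k, z (k+1)⟫ + ⟪Δzb k, zb (k+1)⟫ + ⟪Δy k, y (k+1)⟫
            + ⟪Δyb k, yb (k+1)⟫) : ℝ) : EReal) ≤
      LsigALM σ K Kb b bb c cb A B Bb z' zb' y' yb' (x k) (xb k) +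
        ((σ/2 * (⟪A (z' - z k), EA (A (z' - z k))⟫
            + ⟪Bb (zb' - zb k) + B (z' - z k) + B (adjoint A (y' - y k)),
                Minv (Bb (zb' - zb k) + B (z' - z k) + B (adjoint A (y' - y k)))⟫
            + ⟪y' - y k, J (y' - y k)⟫ + ⟪yb' - yb k, Jb (yb' - yb k)⟫)
          - (⟪Δz k, z'⟫ + ⟪Δzb k, zb'⟫ + ⟪Δy k, y'⟫ + ⟪Δyb k, yb'⟫) : ℝ) : EReal))
    (hstep2x : ∀ k, x (k+1) = x k +
      (τ * σ) • (adjoint A (y (k+1)) + adjoint B (yb (k+1)) + z (k+1) - c))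
    (hstep2xb : ∀ k, xb (k+1) = xb k +
      (τ * σ) • (adjoint Bb (yb (k+1)) + zb (k+1) - cb))
    -- u^k converges to the KKT point û
    (yh : Y) (ybh : Yb) (zh : X) (zbh : Xb) (xh : X) (xbh : Xb)
    (hconv : Filter.Tendsto y Filter.atTop (nhds yh) ∧
      Filter.Tendsto yb Filter.atTop (nhds ybh) ∧
      Filter.Tendsto z Filter.atTop (nhds zh) ∧
      Filter.Tendsto zb Filter.atTop (nhds zbh) ∧
      Filter.Tendsto x Filter.atTop (nhds xh) ∧
      Filter.Tendsto xb Filter.atTop (nhds xbh))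
    (hKKThat : A xh = b ∧ B xh + Bb xbh = bb ∧
      adjoint A yh + adjoint B ybh + zh = c ∧
      adjoint Bb ybh + zbh = cb ∧
      xh = PiK (xh - zh) ∧ xbh = PiKb (xbh - zbh))
    -- the KKT mapping R is metrically subregular at (û, 0)
    (η : ℝ) (hη : 0 < η)
    (hsubreg : ∃ ρ : ℝ, 0 < ρ ∧
      ∀ (y' : Y) (yb' : Yb) (z' : X) (zb' : Xb) (x' : X) (xb' : Xb),
        Real.sqrt (distSq6 y' yb' z' zb' x' xb' yh ybh zh zbh xh xbh) ≤ ρ →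
        sInf {r : ℝ | ∃ (y'' : Y) (yb'' : Yb) (z'' : X) (zb'' : Xb) (x'' : X) (xb'' : Xb),
          (A x'' = b ∧ B x'' + Bb xb'' = bb ∧
            adjoint A y'' + adjoint B yb'' + z'' = c ∧
            adjoint Bb yb'' + zb'' = cb ∧
            x'' = PiK (x'' - z'') ∧ xb'' = PiKb (xb'' - zb'')) ∧
          r = Real.sqrt (distSq6 y' yb' z' zb' x' xb' y'' yb'' z'' zb'' x'' xb'')} ≤
        η * Real.sqrt (‖A x' - b‖^2 + ‖B x' + Bb xb' - bb‖^2 +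
          ‖adjoint A y' + adjoint B yb' + z' - c‖^2 +
          ‖adjoint Bb yb' + zb' - cb‖^2 +
          ‖x' - PiK (x' - z')‖^2 + ‖xb' - PiKb (xb' - zb')‖^2))
    -- the relative error criterion ‖Δ^k‖ ≤ η_k ‖u^k − u^{k+1}‖ with η_k → 0
    (ηs : ℕ → ℝ) (hηs : ∀ k, 0 ≤ ηs k)
    (hηs0 : Filter.Tendsto ηs Filter.atTop (nhds 0))
    (hrel : ∀ k,
      Real.sqrt (‖Δz k‖^2 + ‖Δzb k‖^2 + ‖Δy k‖^2 + ‖Δyb k‖^2) ≤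
      ηs k * Real.sqrt (distSq6 (y k) (yb k) (z k) (zb k) (x k) (xb k)
        (y (k+1)) (yb (k+1)) (z (k+1)) (zb (k+1)) (x (k+1)) (xb (k+1)))) :
    -- local R-linear convergence of u^k to û
    ∃ C : ℝ, 0 < C ∧ ∃ ρ : ℝ, ρ ∈ Set.Ico (0 : ℝ) 1 ∧
      ∀ᶠ k in Filter.atTop,
        Real.sqrt (distSq6 (y k) (yb k) (z k) (zb k) (x k) (xb k)
          yh ybh zh zbh xh xbh) ≤ C * ρ ^ k := by
  obtain ⟨hτ0, hτ2⟩ := hτ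
  -- operators
  have hJs : ∀ a b : Y, ⟪J a, b⟫ = ⟪a, J b⟫ := fun a b => by
    rw [← ContinuousLinearMap.adjoint_inner_right, hJsa]
  have hJbs : ∀ a b : Yb, ⟪Jb a, b⟫ = ⟪a, Jb b⟫ := fun a b => by
    rw [← ContinuousLinearMap.adjoint_inner_right, hJbsa]
  have hNs : ∀ a b : Y, ⟪(A.comp (adjoint A) + J) a, b⟫ = ⟪a, (A.comp (adjoint A) + J) b⟫ := by
    intro a b
    simp only [add_apply, ContinuousLinearMap.comp_apply, inner_add_left,
      inner_add_right, hJs]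
    rw [← ContinuousLinearMap.adjoint_inner_right, ← ContinuousLinearMap.adjoint_inner_left A]
  have hMs : ∀ a b : Yb, ⟪M a, b⟫ = ⟪a, M b⟫ := by
    intro a b
    rw [hM]
    simp only [add_apply, ContinuousLinearMap.comp_apply, inner_add_left,
      inner_add_right, hJbs]
    rw [← ContinuousLinearMap.adjoint_inner_right, ← ContinuousLinearMap.adjoint_inner_left B,
      ← ContinuousLinearMap.adjoint_inner_right Bb, ← ContinuousLinearMap.adjoint_inner_left Bb]
  have hNp : ∀ a : Y, a ≠ 0 → 0 < ⟪a, (A.comp (adjoint A) + J) a⟫ := fun a ha => by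
    simpa using hDμpd a ha
  have hNp' : ∀ a : Y, 0 ≤ ⟪a, (A.comp (adjoint A) + J) a⟫ := fun a => by
    by_cases h : a = 0
    · simp [h]
    · exact (hNp a h).le
  have hMp' : ∀ a : Yb, 0 ≤ ⟪a, M a⟫ := fun a => by
    by_cases h : a = 0
    · simp [h]
    · exact (hDνpd a h).le
  obtain ⟨hEAs, hEAp⟩ := inv_sa _ EA hEA₁ hNs hNp'
  obtain ⟨hMis, hMip⟩ := inv_sa M Minv hMinv₁ hMs hMp'
  have hEA0 : ∀ w : Y, ⟪w, EA w⟫ = 0 → w = 0 := by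
    intro w hw
    have h1 : (A.comp (adjoint A) + J) (EA w) = w := by
      simpa using congrArg (fun f => f w) hEA₁
    by_contra hne
    have h2 : EA w ≠ 0 := fun h => hne (by rw [← h1, h, map_zero])
    have h3 := hNp _ h2
    rw [h1, real_inner_comm, hw] at h3
    exact lt_irrefl _ h3
  have hMi0 : ∀ w : Yb, ⟪w, Minv w⟫ = 0 → w = 0 := by
    intro w hw
    have h1 : M (Minv w) = w := by
      simpa using congrArg (fun f => f w) hMinv₁
    by_contra hne
    have h2 : Minv w ≠ 0 := fun h => hne (by rw [← h1, h, map_zero])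
    have h3 := hDνpd _ h2
    rw [h1, real_inner_comm, hw] at h3
    exact lt_irrefl _ h3
  have hD2 : ∀ w : Yb, w ≠ 0 → 0 < ⟪w, B (adjoint B w) + Bb (adjoint Bb w) + Jb w⟫ := by
    intro w hw
    have := hDνpd w hw
    rw [hM] at this
    simpa using this
  have hg0 : 0 < (2-τ)*σ/8 := by
    have : 0 < 2 - τ := by linarith
    positivity
  obtain ⟨m, MM, hm0, hM0, hQ⟩ := Qf_bounds A B Bb J Jb EA Minv (1/(2*τ*σ)) (σ/2) ((2-τ)*σ/8)
    (by positivity) (by positivity) hg0 hJpsd hJbpsd hEAp hMip hEA0 hMi0 hDμpd hD2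
  obtain ⟨β, _, hβ0, -, hQ'⟩ := Qf_bounds A B Bb J Jb EA Minv ((2-τ)*σ/8/(τ*σ)^2) (σ/2)
    ((2-τ)*σ/8/2) (by positivity) (by positivity) (by positivity) hJpsd hJbpsd hEAp hMip hEA0
    hMi0 hDμpd hD2
  -- KKT points
  have vi : ∀ {xs zs : X}, xs = PiK (xs - zs) → xs ∈ K ∧ ∀ u ∈ K, ⟪-zs, u - xs⟫ ≤ 0 := by
    intro xs zs h
    have h1 := hPiK (xs - zs)
    rw [← h] at h1
    refine ⟨h1.1, fun u hu => ?_⟩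
    have := proj_vi hKcv h1 u hu
    rwa [sub_sub_cancel_left] at this
  have vib : ∀ {xs zs : Xb}, xs = PiKb (xs - zs) → xs ∈ Kb ∧ ∀ u ∈ Kb, ⟪-zs, u - xs⟫ ≤ 0 := by
    intro xs zs h
    have h1 := hPiKb (xs - zs)
    rw [← h] at h1
    refine ⟨h1.1, fun u hu => ?_⟩
    have := proj_vi hKbcv h1 u hu
    rwa [sub_sub_cancel_left] at this
  have hzh : conjFn (indE K) (-zh) ≠ ⊤ := by
    have h1 := (vi hKKThat.2.2.2.2.1).2
    have : conjFn (indE K) (-zh) ≤ ((⟪-zh, xh⟫ : ℝ) : EReal) := (conj_le_iff _ _ _).2 fun u hu => by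
      have := h1 u hu
      rw [inner_sub_right] at this
      exact_mod_cast (by linarith)
    exact ne_top_of_le_ne_top (EReal.coe_ne_top _) this
  have hzbh : conjFn (indE Kb) (-zbh) ≠ ⊤ := by
    have h1 := (vib hKKThat.2.2.2.2.2).2
    have : conjFn (indE Kb) (-zbh) ≤ ((⟪-zbh, xbh⟫ : ℝ) : EReal) :=
      (conj_le_iff _ _ _).2 fun u hu => by
        have := h1 u hu
        rw [inner_sub_right] at this
        exact_mod_cast (by linarith)
    exact ne_top_of_le_ne_top (EReal.coe_ne_top _) this
  -- optimality of each step
  have opt := fun k => step_opt σ hσ K hKne hKcv Kb hKbne hKbcv PiK hPiK PiKb hPiKb b bb c cb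
    A B Bb J Jb EA Minv hJs hJbs hEAs hMis (x k) (xb k) (z k) (zb k) (y k) (yb k)
    (Δz k) (Δzb k) (Δy k) (Δyb k) (z (k+1)) (zb (k+1)) (y (k+1)) (yb (k+1)) _ rfl _ rfl _ rfl
    zh zbh hzh hzbh (by
      intro z' zb' y' yb'
      have := hstep1 k z' zb' y' yb'
      unfold LsigALM at this
      have h : ∀ (E : EReal) (a b : ℝ), E + (a : EReal) + (b : EReal) = E + ((a + b : ℝ) : EReal) :=
        fun E a b => by rw [EReal.coe_add, add_assoc]
      rw [h, h] at this
      unfold Phi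
      exact this)
  let u : ℕ → Y × Yb × X × Xb × X × Xb := fun k => (y k, yb k, z k, zb k, x k, xb k)
  let Ω : Set (Y × Yb × X × Xb × X × Xb) := {w | A w.2.2.2.2.1 = b ∧
    B w.2.2.2.2.1 + Bb w.2.2.2.2.2 = bb ∧
    adjoint A w.1 + adjoint B w.2.1 + w.2.2.1 = c ∧
    adjoint Bb w.2.1 + w.2.2.2.1 = cb ∧
    w.2.2.2.2.1 = PiK (w.2.2.2.2.1 - w.2.2.1) ∧ w.2.2.2.2.2 = PiKb (w.2.2.2.2.2 - w.2.2.2.1)}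
  have hΔ : ∀ k, ‖Δz k‖ ≤ 3 * ηs k * ‖u (k+1) - u k‖ ∧ ‖Δzb k‖ ≤ 3 * ηs k * ‖u (k+1) - u k‖ ∧
      ‖Δy k‖ ≤ 3 * ηs k * ‖u (k+1) - u k‖ ∧ ‖Δyb k‖ ≤ 3 * ηs k * ‖u (k+1) - u k‖ := by
    intro k
    have h1 := hrel k
    have h2 := (sqrt_dist_bounds (y k) (yb k) (z k) (zb k) (x k) (xb k)
        (y (k+1)) (yb (k+1)) (z (k+1)) (zb (k+1)) (x (k+1)) (xb (k+1))).1
    have h3 := mul_le_mul_of_nonneg_left h2 (hηs k)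
    have h4 : ‖u (k+1) - u k‖ = ‖u k - u (k+1)‖ := norm_sub_rev _ _
    have h5 : Real.sqrt (‖Δz k‖^2 + ‖Δzb k‖^2 + ‖Δy k‖^2 + ‖Δyb k‖^2)
        ≤ 3 * ηs k * ‖u (k+1) - u k‖ := by
      rw [h4]
      refine (h1.trans h3).trans (le_of_eq ?_)
      change ηs k * (3 * ‖u k - u (k+1)‖) = _
      ring
    have := sq_nonneg ‖Δz k‖
    have := sq_nonneg ‖Δzb k‖
    have := sq_nonneg ‖Δy k‖
    have := sq_nonneg ‖Δyb k‖
    refine ⟨?_, ?_, ?_, ?_⟩ <;> refine le_trans (Real.le_sqrt_of_sq_le ?_) h5 <;> linarith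
  have hdec : ∀ k, ∀ ω ∈ Ω, Qf A B Bb J Jb EA Minv (1/(2*τ*σ)) (σ/2) ((2-τ)*σ/8) (u (k+1) - ω) ≤
      Qf A B Bb J Jb EA Minv (1/(2*τ*σ)) (σ/2) ((2-τ)*σ/8) (u k - ω) - β * ‖u (k+1) - u k‖^2
      + (12 * ηs k) * ‖u (k+1) - u k‖ * ‖u (k+1) - ω‖ := by
    rintro k ⟨ys, ybs, zs, zbs, xs, xbs⟩ ⟨w1, w2, w3, w4, w5, w6⟩
    simp only at w1 w2 w3 w4 w5 w6
    obtain ⟨⟨o1, o1'⟩, ⟨o2, o2'⟩, o3, o4⟩ := opt k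
    obtain ⟨s1, s1'⟩ := vi w5
    obtain ⟨s2, s2'⟩ := vib w6
    set r := adjoint A (y (k+1)) + adjoint B (yb (k+1)) + z (k+1) - c with hr
    set rb := adjoint Bb (yb (k+1)) + zb (k+1) - cb with hrb
    set e := Bb (zb (k+1) - zb k) + B (z (k+1) - z k) + B (adjoint A (y (k+1) - y k)) with he
    have en := energy σ τ hσ hτ0 hτ2 A B Bb J Jb EA Minv hJs hJbs hEAs hMis
      (y (k+1) - ys) (yb (k+1) - ybs) (z (k+1) - zs) (zb (k+1) - zbs)
      (y (k+1) - y k) (yb (k+1) - yb k) (z (k+1) - z k) (zb (k+1) - zb k)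
      (x k - xs) (xb k - xbs) (Δz k) (Δzb k) (Δy k) (Δyb k)
      r (by rw [hr, ← w3]; simp only [map_sub]; abel)
      rb (by rw [hrb, ← w4]; simp only [map_sub]; abel) e he
      (by
        have t1 := o1' xs s1
        have t2 := s1' _ o1
        have e1 : x k - xs + σ • r + σ • (adjoint A (EA (A (z (k+1) - z k))) + adjoint B (Minv e))
          - Δz k = (x k + σ • r + σ • (adjoint A (EA (A (z (k+1) - z k))) + adjoint B (Minv e))
          - Δz k) - xs := by abel
        rw [e1, inner_sub_left]
        rw [← neg_sub _ xs, inner_neg_left, inner_neg_right] at t1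
        rw [inner_neg_left] at t2
        linarith)
      (by
        have t1 := o2' xbs s2
        have t2 := s2' _ o2
        have e1 : xb k - xbs + σ • rb + σ • adjoint Bb (Minv e)
          - Δzb k = (xb k + σ • rb + σ • adjoint Bb (Minv e)
          - Δzb k) - xbs := by abel
        rw [e1, inner_sub_left]
        rw [← neg_sub _ xbs, inner_neg_left, inner_neg_right] at t1
        rw [inner_neg_left] at t2
        linarith)
      (by
        rw [← o3, ← w1]
        simp only [map_add, map_sub]; abel)
      (by
        rw [← o4, ← w2]
        simp only [map_add, map_sub]; abel)
    have e1 : ((y (k+1) - ys, yb (k+1) - ybs, z (k+1) - zs, zb (k+1) - zbs,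
        x k - xs + (τ*σ) • r, xb k - xbs + (τ*σ) • rb) : Y × Yb × X × Xb × X × Xb)
        = u (k+1) - (ys, ybs, zs, zbs, xs, xbs) := by
      simp only [u, Prod.mk_sub_mk, hstep2x k, hstep2xb k]
      rw [← hr, ← hrb, sub_add_eq_add_sub, sub_add_eq_add_sub]
    have e2 : ((y (k+1) - ys - (y (k+1) - y k), yb (k+1) - ybs - (yb (k+1) - yb k),
        z (k+1) - zs - (z (k+1) - z k), zb (k+1) - zbs - (zb (k+1) - zb k),
        x k - xs, xb k - xbs) : Y × Yb × X × Xb × X × Xb)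
        = u k - (ys, ybs, zs, zbs, xs, xbs) := by
      simp only [u, Prod.mk_sub_mk, sub_sub_sub_cancel_left]
    have e3 : ((y (k+1) - y k, yb (k+1) - yb k, z (k+1) - z k, zb (k+1) - zb k,
        (τ*σ) • r, (τ*σ) • rb) : Y × Yb × X × Xb × X × Xb) = u (k+1) - u k := by
      simp only [u, Prod.mk_sub_mk, hstep2x k, hstep2xb k]
      rw [← hr, ← hrb, add_sub_cancel_left, add_sub_cancel_left]
    rw [e1, e2, e3] at en
    have h1 := (hQ' (u (k+1) - u k)).1
    obtain ⟨d1, d2, d3, d4⟩ := hΔ k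
    set W := u (k+1) - (ys, ybs, zs, zbs, xs, xbs) with hW
    have n3 : ‖y (k+1) - ys‖ ≤ ‖W‖ := norm_fst_le W
    have n4 : ‖yb (k+1) - ybs‖ ≤ ‖W‖ := (norm_fst_le W.2).trans (norm_snd_le W)
    have n1 : ‖z (k+1) - zs‖ ≤ ‖W‖ :=
      (norm_fst_le W.2.2).trans ((norm_snd_le W.2).trans (norm_snd_le W))
    have n2 : ‖zb (k+1) - zbs‖ ≤ ‖W‖ :=
      (norm_fst_le W.2.2.2).trans ((norm_snd_le W.2.2).trans
        ((norm_snd_le W.2).trans (norm_snd_le W)))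
    have D0 : 0 ≤ 3 * ηs k * ‖u (k+1) - u k‖ := (norm_nonneg _).trans d1
    have c1 := (real_inner_le_norm (Δz k) (z (k+1) - zs)).trans
      (mul_le_mul d1 n1 (norm_nonneg _) D0)
    have c2 := (real_inner_le_norm (Δzb k) (zb (k+1) - zbs)).trans
      (mul_le_mul d2 n2 (norm_nonneg _) D0)
    have c3 := (real_inner_le_norm (Δy k) (y (k+1) - ys)).trans
      (mul_le_mul d3 n3 (norm_nonneg _) D0)
    have c4 := (real_inner_le_norm (Δyb k) (yb (k+1) - ybs)).trans
      (mul_le_mul d4 n4 (norm_nonneg _) D0)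
    linarith
  -- limits
  have hlim : Filter.Tendsto u Filter.atTop (nhds (yh, ybh, zh, zbh, xh, xbh)) := by
    obtain ⟨l1, l2, l3, l4, l5, l6⟩ := hconv
    exact l1.prodMk_nhds (l2.prodMk_nhds (l3.prodMk_nhds (l4.prodMk_nhds (l5.prodMk_nhds l6))))
  obtain ⟨C, C0, hC⟩ := resid_const σ τ A B Bb J Jb EA Minv ((1-τ)/τ)
  obtain ⟨ρ, hρ, hsub⟩ := hsubreg
  have hinf : ∀ᶠ k in Filter.atTop,
      Metric.infDist (u (k+1)) Ω ≤ (η * (C + 18)) * ‖u (k+1) - u k‖ := by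
    have h1 : ∀ᶠ k in Filter.atTop, ηs k < 1 := hηs0.eventually_lt_const one_pos
    have h2 : ∀ᶠ k in Filter.atTop, ‖u (k+1) - (yh, ybh, zh, zbh, xh, xbh)‖ < ρ/3 := by
      have h3 := (Filter.tendsto_add_atTop_iff_nat 1).2 hlim
      have h4 := (tendsto_iff_norm_sub_tendsto_zero.1 h3)
      exact h4.eventually_lt_const (by positivity)
    filter_upwards [h1, h2] with k hk1 hk2
    have h3 := hsub (y (k+1)) (yb (k+1)) (z (k+1)) (zb (k+1)) (x (k+1)) (xb (k+1)) (by
      refine (sqrt_dist_bounds _ _ _ _ _ _ _ _ _ _ _ _).1.trans ?_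
      change 3 * ‖u (k+1) - (yh, ybh, zh, zbh, xh, xbh)‖ ≤ ρ
      linarith)
    have h4 : Metric.infDist (u (k+1)) Ω ≤ sInf {r : ℝ | ∃ (y'' : Y) (yb'' : Yb) (z'' : X)
        (zb'' : Xb) (x'' : X) (xb'' : Xb),
          (A x'' = b ∧ B x'' + Bb xb'' = bb ∧
            adjoint A y'' + adjoint B yb'' + z'' = c ∧
            adjoint Bb yb'' + zb'' = cb ∧
            x'' = PiK (x'' - z'') ∧ xb'' = PiKb (xb'' - zb'')) ∧
          r = Real.sqrt (distSq6 (y (k+1)) (yb (k+1)) (z (k+1)) (zb (k+1)) (x (k+1)) (xb (k+1))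
            y'' yb'' z'' zb'' x'' xb'')} := by
      apply le_csInf
      · exact ⟨_, yh, ybh, zh, zbh, xh, xbh, hKKThat, rfl⟩
      · rintro r ⟨y2, yb2, z2, zb2, x2, xb2, hk, rfl⟩
        have hmem : ((y2, yb2, z2, zb2, x2, xb2) : Y × Yb × X × Xb × X × Xb) ∈ Ω := hk
        refine (Metric.infDist_le_dist_of_mem hmem).trans ?_
        rw [dist_eq_norm]
        exact (sqrt_dist_bounds _ _ _ _ _ _ _ _ _ _ _ _).2
    refine (h4.trans h3).trans ?_
    rw [mul_assoc]
    refine mul_le_mul_of_nonneg_left ?_ hη.le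
    refine (sqrt_sum_le _ _ _ _ _ _ (norm_nonneg _) (norm_nonneg _) (norm_nonneg _)
      (norm_nonneg _) (norm_nonneg _) (norm_nonneg _)).trans ?_
    obtain ⟨⟨o1, o1'⟩, ⟨o2, o2'⟩, o3, o4⟩ := opt k
    have hr1 := hstep2x k
    have hr2 := hstep2xb k
    set r := adjoint A (y (k+1)) + adjoint B (yb (k+1)) + z (k+1) - c with hr
    set rb := adjoint Bb (yb (k+1)) + zb (k+1) - cb with hrb
    set e := Bb (zb (k+1) - zb k) + B (z (k+1) - z k) + B (adjoint A (y (k+1) - y k)) with he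
    have hCk := hC (y (k+1) - y k) (yb (k+1) - yb k) (z (k+1) - z k) (zb (k+1) - zb k)
      (x (k+1) - x k) (xb (k+1) - xb k) e he
    have hnorm : ‖((y (k+1) - y k, yb (k+1) - yb k, z (k+1) - z k, zb (k+1) - zb k,
      x (k+1) - x k, xb (k+1) - xb k) : Y × Yb × X × Xb × X × Xb)‖ = ‖u (k+1) - u k‖ := rfl
    rw [hnorm] at hCk
    obtain ⟨d1, d2, d3, d4⟩ := hΔ k
    have hd : 3 * ηs k * ‖u (k+1) - u k‖ ≤ 3 * ‖u (k+1) - u k‖ := by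
      have := norm_nonneg (u (k+1) - u k)
      nlinarith
    have p1 : x k + σ • r = x (k+1) + ((1-τ)/τ) • (x (k+1) - x k) := by
      rw [hr1, add_sub_cancel_left, smul_smul, add_assoc, ← add_smul]
      congr 2
      field_simp; ring
    have p2 : xb k + σ • rb = xb (k+1) + ((1-τ)/τ) • (xb (k+1) - xb k) := by
      rw [hr2, add_sub_cancel_left, smul_smul, add_assoc, ← add_smul]
      congr 2
      field_simp; ring
    rw [p1] at o1 o1' o3 o4
    rw [p2] at o2 o2' o4
    have R1 : ‖A (x (k+1)) - b‖ ≤ ‖((1-τ)/τ) • A (x (k+1) - x k)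
        + σ • (A (adjoint B (Minv e)) + J (y (k+1) - y k))‖ + ‖Δy k‖ := by
      have : A (x (k+1)) - b = Δy k - (((1-τ)/τ) • A (x (k+1) - x k)
        + σ • (A (adjoint B (Minv e)) + J (y (k+1) - y k))) := by
        rw [← sub_eq_zero, ← o3, map_add A, map_smul A]; abel
      rw [this]
      exact (norm_sub_le _ _).trans (le_of_eq (add_comm _ _))
    have R2 : ‖B (x (k+1)) + Bb (xb (k+1)) - bb‖ ≤ ‖((1-τ)/τ) • (B (x (k+1) - x k)
        + Bb (xb (k+1) - xb k)) + σ • Jb (yb (k+1) - yb k)‖ + ‖Δyb k‖ := by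
      have : B (x (k+1)) + Bb (xb (k+1)) - bb = Δyb k - (((1-τ)/τ) • (B (x (k+1) - x k)
        + Bb (xb (k+1) - xb k)) + σ • Jb (yb (k+1) - yb k)) := by
        rw [← sub_eq_zero, ← o4, map_add, map_add, map_smul, map_smul, smul_add]; abel
      rw [this]
      exact (norm_sub_le _ _).trans (le_of_eq (add_comm _ _))
    have R3 : r = (τ*σ)⁻¹ • (x (k+1) - x k) := by
      rw [hr1, add_sub_cancel_left, smul_smul, inv_mul_cancel₀ (by positivity), one_smul]
    have R4 : rb = (τ*σ)⁻¹ • (xb (k+1) - xb k) := by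
      rw [hr2, add_sub_cancel_left, smul_smul, inv_mul_cancel₀ (by positivity), one_smul]
    have R5 := proj_resid hKcv PiK hPiK (z (k+1)) _ (x (k+1)) o1 o1'
    have R6 := proj_resid hKbcv PiKb hPiKb (zb (k+1)) _ (xb (k+1)) o2 o2'
    have R5' : ‖x (k+1) + ((1-τ)/τ) • (x (k+1) - x k) + σ • (adjoint A (EA (A (z (k+1) - z k)))
        + adjoint B (Minv e)) - Δz k - x (k+1)‖ ≤ ‖((1-τ)/τ) • (x (k+1) - x k)
        + σ • (adjoint A (EA (A (z (k+1) - z k))) + adjoint B (Minv e))‖ + ‖Δz k‖ := by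
      refine le_trans (le_of_eq ?_) (norm_sub_le _ _)
      congr 1; abel
    have R6' : ‖xb (k+1) + ((1-τ)/τ) • (xb (k+1) - xb k) + σ • adjoint Bb (Minv e)
        - Δzb k - xb (k+1)‖ ≤ ‖((1-τ)/τ) • (xb (k+1) - xb k)
        + σ • adjoint Bb (Minv e)‖ + ‖Δzb k‖ := by
      refine le_trans (le_of_eq ?_) (norm_sub_le _ _)
      congr 1; abel
    rw [← R3, ← R4] at hCk
    linarith
  obtain ⟨C', C'0, q, hq, hfin⟩ := abs_conv u (yh, ybh, zh, zbh, xh, xbh) Ω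
    ⟨(yh, ybh, zh, zbh, xh, xbh), hKKThat⟩ _ m MM β (η * (C + 18)) hm0 hM0 hβ0 (by positivity)
    (fun v => (hQ v).1) (fun v => (hQ v).2) (fun k => 12 * ηs k)
    (fun k => mul_nonneg (by norm_num) (hηs k)) (by simpa using hηs0.const_mul 12) hdec hinf hlim
  refine ⟨3 * C', by positivity, q, hq, ?_⟩
  filter_upwards [hfin] with k hk
  have h1 := (sqrt_dist_bounds (y k) (yb k) (z k) (zb k) (x k) (xb k) yh ybh zh zbh xh xbh).1
  refine h1.trans ?_
  rw [mul_assoc]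
  exact mul_le_mul_of_nonneg_left hk (by norm_num)

end
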